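/- arXiv:2006.08138 — 2 statements merged into one kernel-verified Lean document; each statement's English description precedes it below -/
import Mathlib

section
/- Let (Z, 𝒜, P) be a probability space, M > 0, f : Z → [0, M] measurable, and let φ : ℝ → ℝ be a disutility function that is Lipschitz with constant L. Write R(f) = ∫ f dP, σ²(f) = ∫ (f − R(f))² dP, σ(f) = √(σ²(f)), and C_φ = inf_{0 < |t| ≤ M} (φ(t) − t)/t², which is a nonnegative real number. Then C_φ·σ²(f) ≤ R(f) − IOCE_φ(f;P) ≤ (L/2)·σ(f). -/
open MeasureTheory Finset Set ENNReal

/-- A disutility function: nondecreasing, convex, `φ(0) = 0`, and `1 ∈ ∂φ(0)` (i.e. `φ(t) ≥ t`). -/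
def IsDisutility (φ : ℝ → ℝ) : Prop :=
  Monotone φ ∧ ConvexOn ℝ Set.univ φ ∧ φ 0 = 0 ∧ ∀ t : ℝ, t ≤ φ t

/-- The optimized certainty equivalent risk `OCE_φ(f;Q) = inf_λ (λ + ∫ φ(f − λ) dQ)`. -/
noncomputable def OCE {Z : Type*} [MeasurableSpace Z] (φ : ℝ → ℝ) (f : Z → ℝ) (Q : Measure Z) : ℝ :=
  ⨅ lam : ℝ, (lam + ∫ z, φ (f z - lam) ∂Q)

/-- The inverted OCE risk `IOCE_φ(f;Q) = sup_λ (λ − ∫ φ(λ − f) dQ)`. -/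
noncomputable def IOCE {Z : Type*} [MeasurableSpace Z] (φ : ℝ → ℝ) (f : Z → ℝ) (Q : Measure Z) : ℝ :=
  ⨆ lam : ℝ, (lam - ∫ z, φ (lam - f z) ∂Q)


theorem IsDisutility.mul_sub_le {φ : ℝ → ℝ} (hφ : IsDisutility φ) {a : ℝ} (h0 : 0 ≤ a)
    (h1 : a ≤ 1) (t : ℝ) : φ (a * t) - a * t ≤ φ t - t := by
  obtain ⟨-, hconv, hzero, hle⟩ := hφ
  have h := hconv.2 (mem_univ t) (mem_univ 0) h0 (sub_nonneg.2 h1) (by ring)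
  simp only [smul_eq_mul, mul_zero, add_zero, hzero] at h
  nlinarith [hle t]

theorem IsDisutility.sub_le_sub_of_nonneg {φ : ℝ → ℝ} (hφ : IsDisutility φ) {s t : ℝ}
    (hs : 0 ≤ s) (hst : s ≤ t) : φ s - s ≤ φ t - t := by
  rcases hst.eq_or_lt with rfl | hlt
  · exact le_rfl
  have ht : 0 < t := hs.trans_lt hlt
  have h := hφ.mul_sub_le (div_nonneg hs ht.le) ((div_le_one ht).2 hst) t
  rwa [div_mul_cancel₀ _ ht.ne'] at h

theorem IsDisutility.sub_le_sub_of_nonpos {φ : ℝ → ℝ} (hφ : IsDisutility φ) {s t : ℝ}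
    (hs : s ≤ 0) (hts : t ≤ s) : φ s - s ≤ φ t - t := by
  rcases hts.eq_or_lt with rfl | hlt
  · exact le_rfl
  have ht : t < 0 := hlt.trans_le hs
  have h := hφ.mul_sub_le (div_nonneg_of_nonpos hs ht.le) ((div_le_one_of_neg ht).2 hts) t
  rwa [div_mul_cancel₀ _ ht.ne] at h

theorem IsDisutility.quotient_nonneg {φ : ℝ → ℝ} (hφ : IsDisutility φ) (t : ℝ) :
    0 ≤ (φ t - t) / t ^ 2 :=
  div_nonneg (sub_nonneg.2 (hφ.2.2.2 t)) (sq_nonneg t)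

theorem IsDisutility.sInf_mul_sq_le {φ : ℝ → ℝ} (hφ : IsDisutility φ) {M t : ℝ} (ht : |t| ≤ M) :
    sInf ((fun t : ℝ => (φ t - t) / t ^ 2) '' {t : ℝ | 0 < |t| ∧ |t| ≤ M}) * t ^ 2 ≤ φ t - t := by
  rcases eq_or_ne t 0 with rfl | h0
  · simp [hφ.2.2.1]
  have hbdd : BddBelow ((fun t : ℝ => (φ t - t) / t ^ 2) '' {t : ℝ | 0 < |t| ∧ |t| ≤ M}) := by
    refine ⟨0, ?_⟩
    rintro _ ⟨u, -, rfl⟩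
    exact hφ.quotient_nonneg u
  exact (le_div_iff₀ (by positivity)).1 (csInf_le hbdd ⟨t, ⟨abs_pos.2 h0, ht⟩, rfl⟩)

/-- The gap `φ(λ - x) - (λ - x)`, for `x ∈ [0, M]`, is bounded below by a multiple of the squared
distance from `x` to a point independent of `x`, namely `λ` clamped to `[0, M]`. -/
theorem IsDisutility.exists_sInf_mul_sq_le {φ : ℝ → ℝ} (hφ : IsDisutility φ) {M : ℝ} (hM : 0 < M)
    (lam : ℝ) : ∃ c : ℝ, ∀ x ∈ Set.Icc 0 M,
      sInf ((fun t : ℝ => (φ t - t) / t ^ 2) '' {t : ℝ | 0 < |t| ∧ |t| ≤ M}) * (c - x) ^ 2 ≤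
        φ (lam - x) - (lam - x) := by
  rcases lt_or_ge lam 0 with h | h
  · refine ⟨0, fun x hx => ?_⟩
    have hx' : |0 - x| ≤ M := abs_le.2 ⟨by linarith [hx.2], by linarith [hx.1]⟩
    exact (hφ.sInf_mul_sq_le hx').trans
      (hφ.sub_le_sub_of_nonpos (by linarith [hx.1]) (by linarith))
  rcases le_or_gt lam M with h' | h'
  · refine ⟨lam, fun x hx => hφ.sInf_mul_sq_le (abs_le.2 ⟨?_, ?_⟩)⟩
    · linarith [hx.2]
    · linarith [hx.1]
  · refine ⟨M, fun x hx => ?_⟩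
    have hx' : |M - x| ≤ M := abs_le.2 ⟨by linarith [hx.2], by linarith [hx.1]⟩
    exact (hφ.sInf_mul_sq_le hx').trans
      (hφ.sub_le_sub_of_nonneg (by linarith [hx.2]) (by linarith))

theorem IsDisutility.sub_le_of_lipschitz {φ : ℝ → ℝ} (hφ : IsDisutility φ) {L : ℝ}
    (hL : ∀ x y : ℝ, |φ x - φ y| ≤ L * |x - y|) (t : ℝ) :
    φ t - t ≤ L / 2 * |t| + (L / 2 - 1) * t := by
  obtain ⟨hmono, -, hzero, -⟩ := hφ
  rcases le_total 0 t with h | h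
  · have h1 := (le_abs_self _).trans (hL t 0)
    rw [hzero, sub_zero, sub_zero, abs_of_nonneg h] at h1
    rw [abs_of_nonneg h]
    linarith
  · have h1 := hmono h
    rw [hzero] at h1
    rw [abs_of_nonpos h]
    linarith

theorem continuous_of_abs_sub_le {φ : ℝ → ℝ} {L : ℝ}
    (hL : ∀ x y : ℝ, |φ x - φ y| ≤ L * |x - y|) : Continuous φ :=
  (LipschitzWith.of_dist_le_mul (K := L.toNNReal) fun x y => by
    rw [Real.dist_eq, Real.dist_eq]
    exact (hL x y).trans
      (mul_le_mul_of_nonneg_right (Real.le_coe_toNNReal L) (abs_nonneg _))).continuous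

section Integral

variable {Z : Type*} [MeasurableSpace Z] {P : Measure Z} [IsProbabilityMeasure P]

theorem integrable_comp_of_mem_Icc {f : Z → ℝ} (hf : Measurable f) {a b : ℝ}
    (hfb : ∀ z, f z ∈ Set.Icc a b) {g : ℝ → ℝ} (hg : Continuous g) :
    Integrable (fun z => g (f z)) P := by
  obtain ⟨C, hC⟩ := isCompact_Icc.exists_bound_of_continuousOn (hg.continuousOn (s := Set.Icc a b))
  exact Integrable.of_bound (hg.measurable.comp hf).aestronglyMeasurable C
    (Filter.Eventually.of_forall fun z => hC _ (hfb z))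

theorem integral_sq_sub_integral_le {f : Z → ℝ} (hf : Integrable f P) (c : ℝ)
    (hR : Integrable (fun z => (f z - ∫ w, f w ∂P) ^ 2) P)
    (hc : Integrable (fun z => (c - f z) ^ 2) P) :
    ∫ z, (f z - ∫ w, f w ∂P) ^ 2 ∂P ≤ ∫ z, (c - f z) ^ 2 ∂P := by
  set R := ∫ w, f w ∂P with hRdef
  have hlin : Integrable (fun z => 2 * (R - c) * (f z - R)) P :=
    (hf.sub (integrable_const R)).const_mul _
  have hz : ∫ z, 2 * (R - c) * (f z - R) ∂P = 0 := by
    rw [integral_const_mul, integral_sub hf (integrable_const R)]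
    simp [← hRdef]
  calc ∫ z, (f z - R) ^ 2 ∂P
      = ∫ z, ((f z - R) ^ 2 + 2 * (R - c) * (f z - R)) ∂P := by
        rw [integral_add hR hlin, hz, add_zero]
    _ ≤ ∫ z, (c - f z) ^ 2 ∂P :=
        integral_mono (hR.add hlin) hc fun z => by
          dsimp only
          nlinarith [sq_nonneg (R - c)]

theorem integral_abs_le_sqrt_integral_sq {g : Z → ℝ} (hg : Integrable g P)
    (hg2 : Integrable (fun z => g z ^ 2) P) :
    ∫ z, |g z| ∂P ≤ Real.sqrt (∫ z, g z ^ 2 ∂P) := by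
  set m := ∫ z, |g z| ∂P with hm
  apply Real.le_sqrt_of_sq_le
  have hi : Integrable (fun z => 2 * m * |g z|) P := hg.abs.const_mul _
  have h : ∫ z, (2 * m * |g z| - m ^ 2) ∂P ≤ ∫ z, g z ^ 2 ∂P :=
    integral_mono (hi.sub (integrable_const _)) hg2 fun z => by
      dsimp only
      nlinarith [sq_nonneg (|g z| - m), sq_abs (g z)]
  rw [integral_sub hi (integrable_const _), integral_const_mul, ← hm] at h
  simp only [integral_const, probReal_univ, one_smul] at h
  linarith

end Integral

/-- variance-based characterization of the inverted OCE risk: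
with `C_φ = inf_{0<|t|≤M} (φ(t)−t)/t²` (a nonnegative real number),
`C_φ·σ²(f) ≤ R(f) − IOCE_φ(f;P) ≤ (L/2)·σ(f)`. -/
theorem ioce_variance_characterization {Z : Type*} [MeasurableSpace Z]
    (P : Measure Z) [IsProbabilityMeasure P] (M : ℝ) (hM : 0 < M)
    (f : Z → ℝ) (hf : Measurable f) (hfb : ∀ z, f z ∈ Set.Icc 0 M)
    (φ : ℝ → ℝ) (hφ : IsDisutility φ)
    (L : ℝ) (hL : ∀ x y : ℝ, |φ x - φ y| ≤ L * |x - y|)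
    (Cφ : ℝ) (hC : Cφ = sInf ((fun t : ℝ => (φ t - t) / t ^ 2) '' {t : ℝ | 0 < |t| ∧ |t| ≤ M})) :
    0 ≤ Cφ ∧
      Cφ * (∫ z, (f z - ∫ w, f w ∂P) ^ 2 ∂P) ≤ (∫ z, f z ∂P) - IOCE φ f P ∧
      (∫ z, f z ∂P) - IOCE φ f P ≤ (L / 2) * Real.sqrt (∫ z, (f z - ∫ w, f w ∂P) ^ 2 ∂P) := by
  have hφc : Continuous φ := continuous_of_abs_sub_le hL
  have hint : ∀ {g : ℝ → ℝ}, Continuous g → Integrable (fun z => g (f z)) P :=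
    fun hg => integrable_comp_of_mem_Icc hf hfb hg
  have hfi : Integrable f P := hint continuous_id
  have hC0 : 0 ≤ Cφ := by
    rw [hC]
    apply Real.sInf_nonneg
    rintro _ ⟨t, -, rfl⟩
    exact hφ.quotient_nonneg t
  set R := ∫ w, f w ∂P with hR
  have hsq : Integrable (fun z => (f z - R) ^ 2) P :=
    hint (g := fun x => (x - R) ^ 2) (by fun_prop)
  have hφi : ∀ lam : ℝ, Integrable (fun z => φ (lam - f z)) P := fun lam =>
    hint (g := fun x => φ (lam - x)) (by fun_prop)
  have hli : ∀ lam : ℝ, Integrable (fun z => lam - f z) P := fun lam =>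
    (integrable_const lam).sub hfi
  have hlv : ∀ lam : ℝ, ∫ z, (lam - f z) ∂P = lam - R := fun lam => by
    rw [integral_sub (integrable_const lam) hfi]
    simp [← hR]
  have hgap : ∀ lam : ℝ, ∫ z, (φ (lam - f z) - (lam - f z)) ∂P =
      R - (lam - ∫ z, φ (lam - f z) ∂P) := fun lam => by
    rw [integral_sub (hφi lam) (hli lam), hlv]
    ring
  have hlower : ∀ lam : ℝ, lam - ∫ z, φ (lam - f z) ∂P ≤
      R - Cφ * ∫ z, (f z - R) ^ 2 ∂P := by
    intro lam
    obtain ⟨c, hc⟩ := hφ.exists_sInf_mul_sq_le hM lam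
    rw [← hC] at hc
    have hci : Integrable (fun z => (c - f z) ^ 2) P :=
      hint (g := fun x => (c - x) ^ 2) (by fun_prop)
    have h1 : ∫ z, Cφ * (c - f z) ^ 2 ∂P ≤ ∫ z, (φ (lam - f z) - (lam - f z)) ∂P :=
      integral_mono (hci.const_mul _) ((hφi lam).sub (hli lam)) fun z => hc _ (hfb z)
    rw [integral_const_mul, hgap] at h1
    have h2 := mul_le_mul_of_nonneg_left (integral_sq_sub_integral_le hfi c hsq hci) hC0
    linarith
  refine ⟨hC0, ?_, ?_⟩
  · have h : IOCE φ f P ≤ R - Cφ * ∫ z, (f z - R) ^ 2 ∂P := ciSup_le hlower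
    linarith
  · have hsup : R - ∫ z, φ (R - f z) ∂P ≤ IOCE φ f P :=
      le_ciSup (f := fun lam : ℝ => lam - ∫ z, φ (lam - f z) ∂P)
        ⟨_, by rintro _ ⟨lam, rfl⟩; exact hlower lam⟩ R
    have hA : Integrable (fun z => L / 2 * |R - f z|) P := (hli R).abs.const_mul _
    have hB : Integrable (fun z => (L / 2 - 1) * (R - f z)) P := (hli R).const_mul _
    have h1 : ∫ z, (φ (R - f z) - (R - f z)) ∂P ≤
        ∫ z, (L / 2 * |R - f z| + (L / 2 - 1) * (R - f z)) ∂P :=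
      integral_mono ((hφi R).sub (hli R)) (hA.add hB) fun z => hφ.sub_le_of_lipschitz hL _
    rw [hgap, integral_add hA hB, integral_const_mul, integral_const_mul, hlv, sub_self,
      mul_zero, add_zero] at h1
    have hsymm : ∀ z, (R - f z) ^ 2 = (f z - R) ^ 2 := fun z => by ring
    have h2 := integral_abs_le_sqrt_integral_sq (hli R) (by simpa only [hsymm] using hsq)
    simp only [hsymm] at h2
    have hL0 : 0 ≤ L := by simpa using (abs_nonneg _).trans (hL 1 0)
    have h3 := mul_le_mul_of_nonneg_left h2 (div_nonneg hL0 zero_le_two)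
    linarith
end

section
/- Let (Z, 𝒜, P) be a probability space, M > 0, F a countable nonempty set of measurable functions f : Z → [0, M], φ : ℝ → ℝ a disutility function that is Lipschitz with constant L, and f₀ ∈ F a fixed hypothesis. Write R(f) = ∫ f dP, and for a sample z^n with empirical measure P_n write σ_n(f) = √( (1/n)·Σᵢ ( f(zᵢ) − (1/n)·Σⱼ f(zⱼ) )² ). Then for every n ≥ 2 and δ ∈ (0,1], the n-fold product measure P^n of the set of samples on which the following holds is at least 1 − δ: every f̂ ∈ F attaining the minimum of IOCE_φ(·;P_n) over F satisfies R(f̂) ≤ R(f₀) + 4·E_{P^n}[Rad_n(F(Z^n))] + 4M·√(log(2/δ))/√n + (L/2)·σ_n(f̂). -/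
open MeasureTheory Finset Set ENNReal

/-- The empirical measure `(1/n)·Σᵢ δ_{zᵢ}` of a sample `z : Fin n → Z`. -/
noncomputable def empMeas {Z : Type*} [MeasurableSpace Z] {n : ℕ} (z : Fin n → Z) : Measure Z :=
  (n : ℝ≥0∞)⁻¹ • ∑ i : Fin n, Measure.dirac (z i)

/-- The Rademacher average of a function class `F` on a sample `z`:
`2^{-n}·Σ_{ε ∈ {−1,1}ⁿ} sup_{f∈F} (1/n)·Σᵢ εᵢ f(zᵢ)`. -/
noncomputable def rad {Z : Type*} {n : ℕ} (F : Set (Z → ℝ)) (z : Fin n → Z) : ℝ :=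
  (2 ^ n : ℝ)⁻¹ * ∑ ε : Fin n → Bool,
    ⨆ f : F, (n : ℝ)⁻¹ * ∑ i : Fin n, (if ε i then (1 : ℝ) else -1) * (f : Z → ℝ) (z i)

open ProbabilityTheory Function
open scoped NNReal

/-- A measurable function whose values are bounded in absolute value is integrable with respect to
a finite measure. -/
lemma integrable_of_abs_le {α : Type*} [MeasurableSpace α] {μ : Measure α} [IsFiniteMeasure μ]
    {f : α → ℝ} (hf : Measurable f) {C : ℝ} (hC : ∀ x, |f x| ≤ C) : Integrable f μ :=
  Integrable.of_bound hf.aestronglyMeasurable C (Filter.Eventually.of_forall hC)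

/-- If the conditional mean of `G` given the first coordinate is sub-Gaussian around its mean, and
`G` is sub-Gaussian around its conditional mean, then `G` is sub-Gaussian around its mean, and the
parameters add up. -/
lemma hasSubgaussianMGF_prod {α β : Type*} [MeasurableSpace α] [MeasurableSpace β]
    {μ : Measure α} {ν : Measure β} [IsProbabilityMeasure μ] [IsProbabilityMeasure ν]
    {G : α × β → ℝ} (hG : Measurable G) {C : ℝ} (hC : ∀ p, |G p| ≤ C) {a b : ℝ≥0}
    (hμ : HasSubgaussianMGF (fun x ↦ ∫ y, G (x, y) ∂ν - ∫ x, ∫ y, G (x, y) ∂ν ∂μ) a μ)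
    (hν : ∀ x, HasSubgaussianMGF (fun y ↦ G (x, y) - ∫ y, G (x, y) ∂ν) b ν) :
    HasSubgaussianMGF (fun p ↦ G p - ∫ p, G p ∂μ.prod ν) (a + b) (μ.prod ν) := by
  have hint : Integrable G (μ.prod ν) := integrable_of_abs_le hG hC
  have hexp (t : ℝ) :
      Integrable (fun p ↦ Real.exp (t * (G p - ∫ p, G p ∂μ.prod ν))) (μ.prod ν) := by
    refine integrable_exp_mul_of_mem_Icc (a := -C - ∫ p, G p ∂μ.prod ν)
      (b := C - ∫ p, G p ∂μ.prod ν) (hG.sub_const _).aemeasurable (.of_forall fun p ↦ ?_)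
    have := abs_le.1 (hC p)
    constructor <;> linarith
  refine ⟨hexp, fun t ↦ ?_⟩
  rw [integral_prod G hint] at hexp ⊢
  set m := ∫ x, ∫ y, G (x, y) ∂ν ∂μ
  have key (x : α) : ∫ y, Real.exp (t * (G (x, y) - m)) ∂ν ≤
      Real.exp (t * (∫ y, G (x, y) ∂ν - m)) * Real.exp (b * t ^ 2 / 2) := by
    have : ∀ y, Real.exp (t * (G (x, y) - m)) = Real.exp (t * (∫ y, G (x, y) ∂ν - m)) *
        Real.exp (t * (G (x, y) - ∫ y, G (x, y) ∂ν)) := fun y ↦ by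
      rw [← Real.exp_add]; congr 1; ring
    simp_rw [this, integral_const_mul]
    gcongr
    exact (hν x).mgf_le t
  calc mgf (fun p ↦ G p - m) (μ.prod ν) t
      = ∫ x, ∫ y, Real.exp (t * (G (x, y) - m)) ∂ν ∂μ := integral_prod _ (hexp t)
    _ ≤ ∫ x, Real.exp (t * (∫ y, G (x, y) ∂ν - m)) * Real.exp (b * t ^ 2 / 2) ∂μ :=
        integral_mono (hexp t).integral_prod_left ((hμ.integrable_exp_mul t).mul_const _) key
    _ ≤ Real.exp (a * t ^ 2 / 2) * Real.exp (b * t ^ 2 / 2) := by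
        rw [integral_mul_const]
        gcongr
        exact hμ.mgf_le t
    _ = Real.exp (↑(a + b) * t ^ 2 / 2) := by
        rw [← Real.exp_add]; push_cast; congr 1; ring

/-- A bounded function whose values differ by at most `c` is sub-Gaussian around its mean, with
parameter `(c / 2) ^ 2`. -/
lemma hasSubgaussianMGF_of_abs_sub_le {α : Type*} [MeasurableSpace α] {μ : Measure α}
    [IsProbabilityMeasure μ] {h : α → ℝ} (hh : Measurable h) {C : ℝ} (hC : ∀ x, |h x| ≤ C)
    {c : ℝ≥0} (hc : ∀ x y, |h x - h y| ≤ c) :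
    HasSubgaussianMGF (fun x ↦ h x - ∫ x, h x ∂μ) ((c / 2) ^ 2) μ := by
  have : Nonempty α := nonempty_of_isProbabilityMeasure μ
  have hbdd : BddBelow (Set.range h) := ⟨-C, by rintro _ ⟨x, rfl⟩; exact (abs_le.1 (hC x)).1⟩
  have hmem : ∀ x, h x ∈ Set.Icc (⨅ x, h x) ((⨅ x, h x) + c) := fun x ↦ by
    refine ⟨ciInf_le hbdd x, ?_⟩
    have : h x - c ≤ ⨅ x, h x := le_ciInf fun y ↦ by linarith [(abs_le.1 (hc x y)).2]
    linarith
  simpa using hasSubgaussianMGF_of_mem_Icc hh.aemeasurable (.of_forall hmem)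

/-- **McDiarmid's inequality**, moment generating function form: a function of independent
variables that changes by at most `c i` when the `i`-th variable is modified is sub-Gaussian around
its mean, with parameter `∑ i, (c i / 2) ^ 2`. -/
theorem hasSubgaussianMGF_pi_of_abs_update_sub_le {Z : Type*} [MeasurableSpace Z] {n : ℕ}
    (P : Fin n → Measure Z) [∀ i, IsProbabilityMeasure (P i)] {g : (Fin n → Z) → ℝ}
    (hg : Measurable g) {C : ℝ} (hC : ∀ z, |g z| ≤ C) (c : Fin n → ℝ≥0)
    (hc : ∀ z i x, |g (update z i x) - g z| ≤ c i) :
    HasSubgaussianMGF (fun z ↦ g z - ∫ z, g z ∂Measure.pi P) (∑ i, (c i / 2) ^ 2)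
      (Measure.pi P) := by
  induction n with
  | zero =>
    have : ∀ z, g z = g default := fun z ↦ by rw [Subsingleton.elim z default]
    simp [this]
  | succ n ih =>
    set Q : Measure (Fin n → Z) := Measure.pi fun j ↦ P j.succ
    have he : MeasurePreserving (MeasurableEquiv.piFinSuccAbove (fun _ ↦ Z) 0) (Measure.pi P)
        ((P 0).prod Q) := measurePreserving_piFinSuccAbove P 0
    set e := MeasurableEquiv.piFinSuccAbove (fun _ : Fin (n + 1) ↦ Z) 0
    set G : Z × (Fin n → Z) → ℝ := fun p ↦ g (e.symm p)
    have hcons : ∀ x y, G (x, y) = g (Fin.cons x y) := fun x y ↦ by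
      simp [G, e, MeasurableEquiv.piFinSuccAbove, Fin.consEquiv]
    have hG : Measurable G := hg.comp e.symm.measurable
    have hGx : ∀ x, Measurable fun y ↦ G (x, y) := fun x ↦ by fun_prop
    have hGint : ∀ x, Integrable (fun y ↦ G (x, y)) Q := fun x ↦
      integrable_of_abs_le (hGx x) fun y ↦ hC _
    have hmain : HasSubgaussianMGF (fun p ↦ G p - ∫ p, G p ∂(P 0).prod Q)
        ((c 0 / 2) ^ 2 + ∑ i : Fin n, (c i.succ / 2) ^ 2) ((P 0).prod Q) := by
      refine hasSubgaussianMGF_prod hG (fun p ↦ hC _) ?_ fun x ↦ ?_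
      · refine hasSubgaussianMGF_of_abs_sub_le
          hG.stronglyMeasurable.integral_prod_right.measurable (C := C) (fun x ↦ ?_) fun x x' ↦ ?_
        · simpa using norm_integral_le_of_norm_le_const (μ := Q) (f := fun y ↦ G (x, y))
            (.of_forall fun y ↦ hC _)
        · rw [← integral_sub (hGint x) (hGint x')]
          have hdiff : ∀ y, ‖G (x, y) - G (x', y)‖ ≤ c 0 := fun y ↦ by
            have := hc (Fin.cons x' y) 0 x
            rwa [Fin.update_cons_zero, ← hcons, ← hcons] at this
          simpa using norm_integral_le_of_norm_le_const (μ := Q) (.of_forall hdiff)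
      · refine ih (fun j ↦ P j.succ) (hGx x) (fun y ↦ hC _) (fun i ↦ c i.succ) fun y i x' ↦ ?_
        have := hc (Fin.cons x y) i.succ x'
        rwa [← Fin.cons_update, ← hcons, ← hcons] at this
    rw [← he.map_eq] at hmain
    have hres := hmain.of_map he.measurable.aemeasurable
    rw [Fin.sum_univ_succ]
    convert hres using 1
    ext z
    rw [integral_map he.measurable.aemeasurable hG.aestronglyMeasurable]
    simp [G]

section Suprema

variable {ι : Type*} {a b : ι → ℝ} {C : ℝ}

lemma bddAbove_range_of_abs_le (ha : ∀ i, |a i| ≤ C) : BddAbove (Set.range a) :=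
  ⟨C, by rintro _ ⟨i, rfl⟩; exact (abs_le.1 (ha i)).2⟩

lemma abs_ciSup_le [Nonempty ι] (ha : ∀ i, |a i| ≤ C) : |⨆ i, a i| ≤ C := by
  obtain ⟨i⟩ := ‹Nonempty ι›
  exact abs_le.2 ⟨(abs_le.1 (ha i)).1.trans (le_ciSup (bddAbove_range_of_abs_le ha) i),
    ciSup_le fun j ↦ (abs_le.1 (ha j)).2⟩

lemma abs_ciSup_sub_ciSup_le [Nonempty ι] (ha : BddAbove (Set.range a))
    (hb : BddAbove (Set.range b)) (hab : ∀ i, |a i - b i| ≤ C) :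
    |(⨆ i, a i) - ⨆ i, b i| ≤ C := by
  have h₁ : ⨆ i, a i ≤ (⨆ i, b i) + C :=
    ciSup_le fun i ↦ by linarith [(abs_le.1 (hab i)).2, le_ciSup hb i]
  have h₂ : ⨆ i, b i ≤ (⨆ i, a i) + C :=
    ciSup_le fun i ↦ by linarith [(abs_le.1 (hab i)).1, le_ciSup ha i]
  exact abs_le.2 ⟨by linarith, by linarith⟩

end Suprema

lemma MeasureTheory.MeasurePreserving.integral_comp_of_measurable {α β : Type*}
    [MeasurableSpace α] [MeasurableSpace β] {μ : Measure α} {ν : Measure β} {T : α → β}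
    (hT : MeasurePreserving T μ ν) {f : β → ℝ} (hf : Measurable f) :
    ∫ x, f (T x) ∂μ = ∫ y, f y ∂ν := by
  rw [← hT.map_eq, integral_map hT.measurable.aemeasurable hf.aestronglyMeasurable]

section Averages

variable {n : ℕ}

lemma abs_inv_mul_sum_le {u : Fin n → ℝ} {C : ℝ} (hC : 0 ≤ C) (hu : ∀ i, |u i| ≤ C) :
    |(n : ℝ)⁻¹ * ∑ i, u i| ≤ C := by
  rcases eq_or_ne n 0 with rfl | hn
  · simpa using hC
  have hn' : (0 : ℝ) < n := by positivity
  rw [abs_mul, abs_of_pos (inv_pos.2 hn'), inv_mul_le_iff₀ hn']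
  calc |∑ i, u i| ≤ ∑ i, |u i| := Finset.abs_sum_le_sum_abs _ _
    _ ≤ ∑ _i : Fin n, C := Finset.sum_le_sum fun i _ ↦ hu i
    _ = n * C := by simp

lemma abs_inv_mul_sum_update_sub_le {Z : Type*} {f : Z → ℝ} {M : ℝ}
    (hf : ∀ z, f z ∈ Set.Icc 0 M) (z : Fin n → Z) (i : Fin n) (x : Z) :
    |(n : ℝ)⁻¹ * ∑ j, f (update z i x j) - (n : ℝ)⁻¹ * ∑ j, f (z j)| ≤ M / n := by
  have hsum : ∑ j, f (update z i x j) - ∑ j, f (z j) = f x - f (z i) := by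
    rw [← Finset.sum_sub_distrib, Finset.sum_eq_single i]
    · simp
    · intro j _ hj
      simp [update_of_ne hj]
    · simp
  rw [← mul_sub, hsum, abs_mul, abs_of_nonneg (by positivity), div_eq_inv_mul]
  gcongr
  exact abs_le.2 ⟨by linarith [(hf x).1, (hf (z i)).2], by linarith [(hf x).2, (hf (z i)).1]⟩

lemma integral_inv_mul_sum_pi {Z : Type*} [MeasurableSpace Z] (P : Measure Z)
    [IsProbabilityMeasure P] (hn : n ≠ 0) {f : Z → ℝ} (hf : Measurable f) (hfi : Integrable f P) :
    ∫ z, (n : ℝ)⁻¹ * ∑ i, f (z i) ∂(Measure.pi fun _ : Fin n ↦ P) = ∫ w, f w ∂P := by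
  have hmp (i : Fin n) := measurePreserving_eval (fun _ : Fin n ↦ P) i
  rw [integral_const_mul, integral_finsetSum]
  · have (i : Fin n) : ∫ z : Fin n → Z, f (z i) ∂(Measure.pi fun _ : Fin n ↦ P) = ∫ w, f w ∂P :=
      (hmp i).integral_comp_of_measurable hf
    simp only [this]
    simp [hn]
  · exact fun i _ ↦ (hmp i).integrable_comp_of_integrable hfi

end Averages

section Symmetrization

variable {Z : Type*} {n : ℕ}

/-- The supremum over `f ∈ F` of the average of `ε i * f (z i)`. -/
noncomputable def signedSup (F : Set (Z → ℝ)) (ε : Fin n → Bool) (z : Fin n → Z) : ℝ :=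
  ⨆ f : F, (n : ℝ)⁻¹ * ∑ i : Fin n, (if ε i then (1 : ℝ) else -1) * (f : Z → ℝ) (z i)

/-- The supremum over `f ∈ F` of the average of `ε i * (f (z' i) - f (z i))` over a pair of
samples. -/
noncomputable def signedDiffSup (F : Set (Z → ℝ)) (ε : Fin n → Bool)
    (p : (Fin n → Z) × (Fin n → Z)) : ℝ :=
  ⨆ f : F, (n : ℝ)⁻¹ * ∑ i : Fin n,
    (if ε i then (1 : ℝ) else -1) * ((f : Z → ℝ) (p.2 i) - (f : Z → ℝ) (p.1 i))

/-- The exchange of the coordinates of two samples at the indices where `ε` is `false`. -/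
def swapSamples (ε : Fin n → Bool) (p : (Fin n → Z) × (Fin n → Z)) :
    (Fin n → Z) × (Fin n → Z) :=
  (fun i ↦ if ε i then p.1 i else p.2 i, fun i ↦ if ε i then p.2 i else p.1 i)

lemma measurePreserving_swapSamples [MeasurableSpace Z] (P : Measure Z) [IsProbabilityMeasure P]
    (ε : Fin n → Bool) :
    MeasurePreserving (swapSamples (Z := Z) ε)
      ((Measure.pi fun _ ↦ P).prod (Measure.pi fun _ ↦ P))
      ((Measure.pi fun _ ↦ P).prod (Measure.pi fun _ ↦ P)) := by
  have he := measurePreserving_arrowProdEquivProdArrow Z Z (Fin n) (fun _ ↦ P) (fun _ ↦ P)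
  have hs : MeasurePreserving (fun (w : Fin n → Z × Z) i ↦ if ε i then w i else (w i).swap)
      (Measure.pi fun _ ↦ P.prod P) (Measure.pi fun _ ↦ P.prod P) := by
    refine measurePreserving_pi (fun _ : Fin n ↦ P.prod P) (fun _ ↦ P.prod P)
      (f := fun i p ↦ if ε i then p else p.swap) fun i ↦ ?_
    cases ε i
    · simpa using! Measure.measurePreserving_swap (μ := P) (ν := P)
    · simpa using! MeasurePreserving.id (P.prod P)
  convert (he.comp hs).comp (he.symm _) using 1
  ext p i
  all_goals
    cases h : ε i <;> simp [swapSamples, MeasurableEquiv.arrowProdEquivProdArrow,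
      Equiv.arrowProdEquivProdArrow, h]

lemma signedDiffSup_swapSamples (F : Set (Z → ℝ)) (ε : Fin n → Bool)
    (p : (Fin n → Z) × (Fin n → Z)) :
    signedDiffSup F (fun _ ↦ true) (swapSamples ε p) = signedDiffSup F ε p := by
  unfold signedDiffSup swapSamples
  refine iSup_congr fun f ↦ ?_
  congr! 2 with i
  by_cases h : ε i = true <;> simp [h]

variable {F : Set (Z → ℝ)} {M : ℝ}

lemma abs_signedAverage_le (hM : 0 ≤ M) {f : Z → ℝ} (hf : ∀ z, f z ∈ Set.Icc 0 M)
    (ε : Fin n → Bool) (z : Fin n → Z) :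
    |(n : ℝ)⁻¹ * ∑ i : Fin n, (if ε i then (1 : ℝ) else -1) * f (z i)| ≤ M := by
  refine abs_inv_mul_sum_le hM fun i ↦ ?_
  have := hf (z i)
  split_ifs <;> simpa [abs_of_nonneg this.1] using this.2

lemma abs_signedDiffAverage_le (hM : 0 ≤ M) {f : Z → ℝ} (hf : ∀ z, f z ∈ Set.Icc 0 M)
    (ε : Fin n → Bool) (p : (Fin n → Z) × (Fin n → Z)) :
    |(n : ℝ)⁻¹ * ∑ i : Fin n, (if ε i then (1 : ℝ) else -1) * (f (p.2 i) - f (p.1 i))| ≤ M := by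
  refine abs_inv_mul_sum_le hM fun i ↦ ?_
  have h₁ := hf (p.1 i)
  have h₂ := hf (p.2 i)
  rw [abs_le]
  split_ifs <;> constructor <;> linarith [h₁.1, h₁.2, h₂.1, h₂.2]

lemma abs_signedSup_le (hM : 0 ≤ M) (hFne : F.Nonempty)
    (hFbd : ∀ f ∈ F, ∀ z, f z ∈ Set.Icc 0 M) (ε : Fin n → Bool) (z : Fin n → Z) :
    |signedSup F ε z| ≤ M :=
  have := hFne.to_subtype
  abs_ciSup_le fun f ↦ abs_signedAverage_le hM (hFbd f f.2) ε z

lemma abs_signedDiffSup_le (hM : 0 ≤ M) (hFne : F.Nonempty)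
    (hFbd : ∀ f ∈ F, ∀ z, f z ∈ Set.Icc 0 M) (ε : Fin n → Bool)
    (p : (Fin n → Z) × (Fin n → Z)) : |signedDiffSup F ε p| ≤ M :=
  have := hFne.to_subtype
  abs_ciSup_le fun f ↦ abs_signedDiffAverage_le hM (hFbd f f.2) ε p

lemma signedDiffSup_le (hM : 0 ≤ M) (hFne : F.Nonempty)
    (hFbd : ∀ f ∈ F, ∀ z, f z ∈ Set.Icc 0 M) (ε : Fin n → Bool)
    (p : (Fin n → Z) × (Fin n → Z)) :
    signedDiffSup F ε p ≤ signedSup F (fun i ↦ !ε i) p.1 + signedSup F ε p.2 := by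
  have := hFne.to_subtype
  refine ciSup_le fun f ↦ ?_
  have hle (ε : Fin n → Bool) (z : Fin n → Z) :
      (n : ℝ)⁻¹ * ∑ i : Fin n, (if ε i then (1 : ℝ) else -1) * (f : Z → ℝ) (z i) ≤
        signedSup F ε z :=
    le_ciSup (bddAbove_range_of_abs_le fun f : F ↦ abs_signedAverage_le hM (hFbd f f.2) ε z) f
  refine le_of_eq_of_le ?_ (add_le_add (hle _ _) (hle _ _))
  rw [← mul_add, ← Finset.sum_add_distrib]
  congr! 2 with i
  cases ε i <;> simp <;> ring

lemma average_mem_Icc (hM : 0 ≤ M) {f : Z → ℝ} (hf : ∀ z, f z ∈ Set.Icc 0 M) (z : Fin n → Z) :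
    (n : ℝ)⁻¹ * ∑ i, f (z i) ∈ Set.Icc 0 M := by
  refine ⟨mul_nonneg (by positivity) (Finset.sum_nonneg fun i _ ↦ (hf (z i)).1), ?_⟩
  refine (le_abs_self _).trans (abs_inv_mul_sum_le hM fun i ↦ ?_)
  exact abs_le.2 ⟨by linarith [(hf (z i)).1], (hf (z i)).2⟩

lemma sum_signedSup_not (F : Set (Z → ℝ)) (z : Fin n → Z) :
    ∑ ε : Fin n → Bool, signedSup F (fun i ↦ !ε i) z = ∑ ε : Fin n → Bool, signedSup F ε z :=
  (Equiv.piCongrRight fun _ : Fin n ↦ Equiv.boolNot).sum_comp fun ε ↦ signedSup F ε z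

lemma rad_nonneg (hM : 0 ≤ M) (hFne : F.Nonempty) (hFbd : ∀ f ∈ F, ∀ z, f z ∈ Set.Icc 0 M)
    (z : Fin n → Z) : 0 ≤ rad F z := by
  have hdiag (ε : Fin n → Bool) : 0 ≤ signedSup F (fun i ↦ !ε i) z + signedSup F ε z := by
    simpa [signedDiffSup] using signedDiffSup_le hM hFne hFbd ε (z, z)
  have hsum := Finset.sum_nonneg fun (ε : Fin n → Bool) (_ : ε ∈ Finset.univ) ↦ hdiag ε
  rw [Finset.sum_add_distrib, sum_signedSup_not] at hsum
  exact mul_nonneg (by positivity) (by unfold signedSup at hsum; linarith)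

variable [MeasurableSpace Z]

lemma measurable_signedSup (hFc : F.Countable) (hFmeas : ∀ f ∈ F, Measurable f)
    (ε : Fin n → Bool) : Measurable (signedSup F ε) := by
  have := hFc.to_subtype
  refine Measurable.iSup fun f ↦ ?_
  have := hFmeas f f.2
  fun_prop

lemma measurable_signedDiffSup (hFc : F.Countable) (hFmeas : ∀ f ∈ F, Measurable f)
    (ε : Fin n → Bool) : Measurable (signedDiffSup F ε) := by
  have := hFc.to_subtype
  refine Measurable.iSup fun f ↦ ?_
  have := hFmeas f f.2
  fun_prop

/-- The uniform one-sided deviation `sup_{f ∈ F} (∫ f dP - (1/n)·∑ᵢ f(zᵢ))`. -/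
noncomputable def deviationSup (P : Measure Z) (F : Set (Z → ℝ)) (z : Fin n → Z) : ℝ :=
  ⨆ f : F, (∫ w, (f : Z → ℝ) w ∂P - (n : ℝ)⁻¹ * ∑ i, (f : Z → ℝ) (z i))

lemma abs_integral_sub_average_le (P : Measure Z) [IsProbabilityMeasure P] (hM : 0 ≤ M)
    {f : Z → ℝ} (hfm : Measurable f) (hf : ∀ z, f z ∈ Set.Icc 0 M) (z : Fin n → Z) :
    |∫ w, f w ∂P - (n : ℝ)⁻¹ * ∑ i, f (z i)| ≤ M := by
  have h₁ : 0 ≤ ∫ w, f w ∂P := integral_nonneg fun w ↦ (hf w).1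
  have h₂ : ∫ w, f w ∂P ≤ M := by
    simpa using integral_mono (μ := P) (Integrable.of_mem_Icc 0 M hfm.aemeasurable (.of_forall hf))
      (integrable_const M) fun w ↦ (hf w).2
  have h₃ := average_mem_Icc hM hf z
  exact abs_le.2 ⟨by linarith [h₃.2], by linarith [h₃.1]⟩

lemma abs_deviationSup_le (P : Measure Z) [IsProbabilityMeasure P] (hM : 0 ≤ M)
    (hFne : F.Nonempty) (hFmeas : ∀ f ∈ F, Measurable f)
    (hFbd : ∀ f ∈ F, ∀ z, f z ∈ Set.Icc 0 M) (z : Fin n → Z) : |deviationSup P F z| ≤ M :=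
  have := hFne.to_subtype
  abs_ciSup_le fun f ↦ abs_integral_sub_average_le P hM (hFmeas f f.2) (hFbd f f.2) z

lemma measurable_deviationSup (P : Measure Z) (hFc : F.Countable)
    (hFmeas : ∀ f ∈ F, Measurable f) :
    Measurable (deviationSup P F : (Fin n → Z) → ℝ) := by
  have := hFc.to_subtype
  refine Measurable.iSup fun f ↦ ?_
  have := hFmeas f f.2
  fun_prop

lemma abs_deviationSup_update_sub_le (P : Measure Z) [IsProbabilityMeasure P] (hM : 0 ≤ M)
    (hFne : F.Nonempty) (hFmeas : ∀ f ∈ F, Measurable f)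
    (hFbd : ∀ f ∈ F, ∀ z, f z ∈ Set.Icc 0 M) (z : Fin n → Z) (i : Fin n) (x : Z) :
    |deviationSup P F (update z i x) - deviationSup P F z| ≤ M / n := by
  have := hFne.to_subtype
  have hbdd (z : Fin n → Z) := bddAbove_range_of_abs_le fun f : F ↦
    abs_integral_sub_average_le P hM (hFmeas f f.2) (hFbd f f.2) z
  refine abs_ciSup_sub_ciSup_le (hbdd _) (hbdd _) fun f ↦ ?_
  rw [sub_sub_sub_comm, sub_self, zero_sub, abs_neg]
  exact abs_inv_mul_sum_update_sub_le (hFbd f f.2) z i x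

/-- **Symmetrization**: the expected uniform deviation of the empirical means from the means is at
most twice the expected Rademacher average. -/
theorem integral_deviationSup_le (P : Measure Z) [IsProbabilityMeasure P]
    (hM : 0 ≤ M) (hFc : F.Countable) (hFne : F.Nonempty) (hFmeas : ∀ f ∈ F, Measurable f)
    (hFbd : ∀ f ∈ F, ∀ z, f z ∈ Set.Icc 0 M) (hn : n ≠ 0) :
    ∫ z, deviationSup P F z ∂(Measure.pi fun _ : Fin n ↦ P) ≤
      2 * ∫ z, rad F z ∂(Measure.pi fun _ : Fin n ↦ P) := by
  have := hFne.to_subtype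
  set Q : Measure (Fin n → Z) := Measure.pi fun _ : Fin n ↦ P
  have hSint (ε : Fin n → Bool) : Integrable (signedSup F ε) Q :=
    integrable_of_abs_le (measurable_signedSup hFc hFmeas ε) (abs_signedSup_le hM hFne hFbd ε)
  have hTint (ε : Fin n → Bool) : Integrable (signedDiffSup F ε) (Q.prod Q) :=
    integrable_of_abs_le (measurable_signedDiffSup hFc hFmeas ε)
      (abs_signedDiffSup_le hM hFne hFbd ε)
  have hfint (f : F) : Integrable (f : Z → ℝ) P :=
    Integrable.of_mem_Icc 0 M (hFmeas f f.2).aemeasurable (.of_forall (hFbd f f.2))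
  have hpoint (z : Fin n → Z) :
      deviationSup P F z ≤ ∫ z', signedDiffSup F (fun _ ↦ true) (z, z') ∂Q := by
    refine ciSup_le fun f ↦ ?_
    have hf := hFmeas f f.2
    have hAint : Integrable (fun z' : Fin n → Z ↦ (n : ℝ)⁻¹ * ∑ i, (f : Z → ℝ) (z' i)) Q :=
      integrable_of_abs_le (by fun_prop) (C := M) fun z' ↦ by
        have := average_mem_Icc hM (hFbd f f.2) z'
        rw [abs_of_nonneg this.1]
        exact this.2
    rw [← integral_inv_mul_sum_pi P hn hf (hfint f)]
    calc _ = ∫ z', ((n : ℝ)⁻¹ * ∑ i, (f : Z → ℝ) (z' i) -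
              (n : ℝ)⁻¹ * ∑ i, (f : Z → ℝ) (z i)) ∂Q := by
          rw [integral_sub hAint (integrable_const _)]
          simp [Q]
      _ ≤ _ := by
          refine integral_mono (hAint.sub (integrable_const _))
            (integrable_of_abs_le
              ((measurable_signedDiffSup hFc hFmeas _).comp measurable_prodMk_left)
              fun z' ↦ abs_signedDiffSup_le hM hFne hFbd _ (z, z')) fun z' ↦ ?_
          refine le_of_eq_of_le ?_ (le_ciSup (bddAbove_range_of_abs_le fun f : F ↦
            abs_signedDiffAverage_le hM (hFbd f f.2) (fun _ ↦ true) (z, z')) f)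
          simp [mul_sub]
  have hDint : Integrable (deviationSup P F) Q :=
    integrable_of_abs_le (measurable_deviationSup P hFc hFmeas)
      (abs_deviationSup_le P hM hFne hFmeas hFbd)
  have hswap (ε : Fin n → Bool) :
      ∫ z, deviationSup P F z ∂Q ≤
        ∫ z, signedSup F (fun i ↦ !ε i) z ∂Q + ∫ z, signedSup F ε z ∂Q := by
    calc ∫ z, deviationSup P F z ∂Q
        ≤ ∫ z, ∫ z', signedDiffSup F (fun _ ↦ true) (z, z') ∂Q ∂Q :=
          integral_mono hDint (hTint _).integral_prod_left hpoint
      _ = ∫ p, signedDiffSup F (fun _ ↦ true) p ∂(Q.prod Q) := (integral_prod _ (hTint _)).symm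
      _ = ∫ p, signedDiffSup F ε p ∂(Q.prod Q) := by
          rw [← (measurePreserving_swapSamples P ε).integral_comp_of_measurable
            (measurable_signedDiffSup hFc hFmeas _)]
          simp_rw [signedDiffSup_swapSamples]
          rfl
      _ ≤ ∫ p, (signedSup F (fun i ↦ !ε i) p.1 + signedSup F ε p.2) ∂(Q.prod Q) :=
          integral_mono (hTint ε) (((hSint _).comp_fst Q).add ((hSint ε).comp_snd Q))
            (signedDiffSup_le hM hFne hFbd ε)
      _ = _ := by
          rw [integral_add ((hSint _).comp_fst Q) ((hSint ε).comp_snd Q),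
            integral_fun_fst, integral_fun_snd]
          simp [Q]
  have hnot : ∑ ε : Fin n → Bool, ∫ z, signedSup F (fun i ↦ !ε i) z ∂Q =
      ∑ ε : Fin n → Bool, ∫ z, signedSup F ε z ∂Q := by
    rw [← integral_finsetSum _ fun ε _ ↦ hSint _, ← integral_finsetSum _ fun ε _ ↦ hSint ε]
    simp_rw [sum_signedSup_not]
  have hrad : ∫ z, rad F z ∂Q = (2 ^ n : ℝ)⁻¹ * ∑ ε : Fin n → Bool, ∫ z, signedSup F ε z ∂Q := by
    rw [← integral_finsetSum _ fun ε _ ↦ hSint ε, ← integral_const_mul]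
    rfl
  have hsum := Finset.sum_le_sum fun (ε : Fin n → Bool) (_ : ε ∈ Finset.univ) ↦ hswap ε
  rw [Finset.sum_add_distrib, hnot] at hsum
  simp only [Finset.sum_const, Finset.card_univ, Fintype.card_fun, Fintype.card_bool,
    Fintype.card_fin, nsmul_eq_mul, Nat.cast_pow, Nat.cast_ofNat] at hsum
  rw [hrad, mul_left_comm, le_inv_mul_iff₀ (by positivity)]
  linarith

end Symmetrization

section InvertedOCE

variable {Z : Type*} [MeasurableSpace Z] {n : ℕ}

lemma integral_empMeas (z : Fin n → Z) {g : Z → ℝ} (hg : Measurable g) :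
    ∫ w, g w ∂(empMeas z) = (n : ℝ)⁻¹ * ∑ i, g (z i) := by
  rw [empMeas, integral_smul_measure, integral_finsetSum_measure
    fun i _ ↦ integrable_dirac' hg.stronglyMeasurable (by simp)]
  simp_rw [integral_dirac' g _ hg.stronglyMeasurable]
  simp

variable {φ : ℝ → ℝ} {f : Z → ℝ}

lemma sub_integral_empMeas_le (hn : n ≠ 0) (hφ : IsDisutility φ) (hf : Measurable f)
    (z : Fin n → Z) (lam : ℝ) :
    lam - ∫ w, φ (lam - f w) ∂(empMeas z) ≤ (n : ℝ)⁻¹ * ∑ i, f (z i) := by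
  have hφf : Measurable fun w ↦ φ (lam - f w) := hφ.1.measurable.comp (hf.const_sub lam)
  rw [integral_empMeas z hφf]
  have hsum : ∑ i, (lam - f (z i)) ≤ ∑ i, φ (lam - f (z i)) :=
    Finset.sum_le_sum fun i _ ↦ hφ.2.2.2 _
  have hn' : (n : ℝ) ≠ 0 := by exact_mod_cast hn
  have hmul := mul_le_mul_of_nonneg_left hsum (inv_nonneg.2 (Nat.cast_nonneg n : (0 : ℝ) ≤ n))
  simp only [Finset.sum_sub_distrib, Finset.sum_const, Finset.card_univ, Fintype.card_fin,
    nsmul_eq_mul, mul_sub, inv_mul_cancel_left₀ hn'] at hmul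
  linarith

/-- The inverted OCE risk of the empirical measure is at most the empirical mean. -/
lemma IOCE_empMeas_le_average (hn : n ≠ 0) (hφ : IsDisutility φ) (hf : Measurable f)
    (z : Fin n → Z) : IOCE φ f (empMeas z) ≤ (n : ℝ)⁻¹ * ∑ i, f (z i) :=
  ciSup_le (sub_integral_empMeas_le hn hφ hf z)

lemma IsDisutility.le_half_mul_add_abs {L : ℝ} (hφ : IsDisutility φ)
    (hL : ∀ x y : ℝ, |φ x - φ y| ≤ L * |x - y|) (t : ℝ) : φ t ≤ L / 2 * (t + |t|) := by
  rcases le_total 0 t with ht | ht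
  · have := hL t 0
    rw [hφ.2.2.1, sub_zero, sub_zero, abs_of_nonneg ht] at this
    rw [abs_of_nonneg ht]
    linarith [le_abs_self (φ t)]
  · have := hφ.1 ht
    rw [hφ.2.2.1] at this
    rw [abs_of_nonpos ht]
    linarith

/-- The average of the absolute values is at most the root mean square. -/
lemma inv_mul_sum_abs_le_sqrt (u : Fin n → ℝ) :
    (n : ℝ)⁻¹ * ∑ i, |u i| ≤ √((n : ℝ)⁻¹ * ∑ i, u i ^ 2) := by
  rcases eq_or_ne n 0 with rfl | hn
  · simp
  refine Real.le_sqrt_of_sq_le ?_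
  have hn' : (0 : ℝ) < n := by positivity
  have h : (∑ i, |u i|) ^ 2 ≤ n * ∑ i, u i ^ 2 := by
    simpa using sq_sum_le_card_mul_sum_sq (s := Finset.univ) (f := fun i ↦ |u i|)
  calc ((n : ℝ)⁻¹ * ∑ i, |u i|) ^ 2 = (n : ℝ)⁻¹ ^ 2 * (∑ i, |u i|) ^ 2 := mul_pow _ _ _
    _ ≤ (n : ℝ)⁻¹ ^ 2 * (n * ∑ i, u i ^ 2) := by gcongr
    _ = (n : ℝ)⁻¹ * ∑ i, u i ^ 2 := by field_simp

/-- The empirical mean exceeds the inverted OCE risk of the empirical measure by at most `L / 2`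
times the empirical standard deviation. -/
lemma average_le_IOCE_empMeas_add (hn : n ≠ 0) (hφ : IsDisutility φ) {L : ℝ}
    (hL : ∀ x y : ℝ, |φ x - φ y| ≤ L * |x - y|) (hf : Measurable f) (z : Fin n → Z) :
    (n : ℝ)⁻¹ * ∑ i, f (z i) ≤ IOCE φ f (empMeas z) +
      (L / 2) * √((n : ℝ)⁻¹ * ∑ i, (f (z i) - (n : ℝ)⁻¹ * ∑ j, f (z j)) ^ 2) := by
  set m := (n : ℝ)⁻¹ * ∑ i, f (z i) with hm
  have hn' : (n : ℝ) ≠ 0 := by exact_mod_cast hn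
  have hL0 : 0 ≤ L := by simpa using (abs_nonneg _).trans (hL 1 0)
  have hle : m - ∫ w, φ (m - f w) ∂(empMeas z) ≤ IOCE φ f (empMeas z) :=
    le_ciSup (f := fun lam ↦ lam - ∫ w, φ (lam - f w) ∂(empMeas z))
      ⟨m, by rintro _ ⟨lam, rfl⟩; exact sub_integral_empMeas_le hn hφ hf z lam⟩ m
  have hφf : Measurable fun w ↦ φ (m - f w) := hφ.1.measurable.comp (hf.const_sub m)
  rw [integral_empMeas z hφf] at hle
  have hcentered : ∑ i, (m - f (z i)) = 0 := by
    rw [Finset.sum_sub_distrib, hm]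
    simp [hn']
  have hbound : (n : ℝ)⁻¹ * ∑ i, φ (m - f (z i)) ≤
      L / 2 * √((n : ℝ)⁻¹ * ∑ i, (f (z i) - m) ^ 2) :=
    calc (n : ℝ)⁻¹ * ∑ i, φ (m - f (z i))
        ≤ (n : ℝ)⁻¹ * ∑ i, L / 2 * ((m - f (z i)) + |m - f (z i)|) := by
          gcongr with i
          exact hφ.le_half_mul_add_abs hL _
      _ = L / 2 * ((n : ℝ)⁻¹ * ∑ i, |f (z i) - m|) := by
          rw [← Finset.mul_sum, Finset.sum_add_distrib, hcentered, zero_add, mul_left_comm]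
          simp_rw [abs_sub_comm m]
      _ ≤ _ := by
          gcongr
          exact inv_mul_sum_abs_le_sqrt _
  linarith

end InvertedOCE

/-- With probability at least `1 - δ`, the uniform deviation of the empirical means over `F` plus
the deviation of the empirical mean of a fixed `f₀ ∈ F` is controlled by the expected Rademacher
average. -/
theorem ofReal_le_measure_deviationSup_add_lt {Z : Type*} [MeasurableSpace Z] (P : Measure Z)
    [IsProbabilityMeasure P] {M : ℝ} (hM : 0 < M) {F : Set (Z → ℝ)} (hFc : F.Countable)
    (hFmeas : ∀ f ∈ F, Measurable f) (hFbd : ∀ f ∈ F, ∀ z, f z ∈ Set.Icc 0 M)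
    {f₀ : Z → ℝ} (hf₀ : f₀ ∈ F) {n : ℕ} (hn : n ≠ 0) {δ : ℝ} (hδ : δ ∈ Set.Ioc (0 : ℝ) 1) :
    ENNReal.ofReal (1 - δ) ≤ (Measure.pi fun _ : Fin n ↦ P) {z |
      deviationSup P F z + ((n : ℝ)⁻¹ * ∑ i, f₀ (z i) - ∫ w, f₀ w ∂P) <
        2 * (∫ z, rad F z ∂(Measure.pi fun _ : Fin n ↦ P)) +
          4 * M * √(Real.log (2 / δ)) / √n} := by
  obtain ⟨hδ0, hδ1⟩ := hδ
  have hFne : F.Nonempty := ⟨f₀, hf₀⟩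
  have hf₀m := hFmeas f₀ hf₀
  have hn' : (0 : ℝ) < n := by positivity
  set Q : Measure (Fin n → Z) := Measure.pi fun _ ↦ P
  set G : (Fin n → Z) → ℝ :=
    fun z ↦ deviationSup P F z + ((n : ℝ)⁻¹ * ∑ i, f₀ (z i) - ∫ w, f₀ w ∂P)
  have hdev : Measurable (deviationSup P F : (Fin n → Z) → ℝ) :=
    measurable_deviationSup P hFc hFmeas
  have havg : Measurable fun z : Fin n → Z ↦ (n : ℝ)⁻¹ * ∑ i, f₀ (z i) := by fun_prop
  have hG : Measurable G := hdev.add (havg.sub_const _)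
  have hGbd (z : Fin n → Z) : |G z| ≤ M + M := by
    refine (abs_add_le _ _).trans (add_le_add (abs_deviationSup_le P hM.le hFne hFmeas hFbd z) ?_)
    rw [abs_sub_comm]
    exact abs_integral_sub_average_le P hM.le hf₀m (hFbd f₀ hf₀) z
  obtain ⟨c, hc⟩ : ∃ c : ℝ≥0, (c : ℝ) = 2 * M / n := ⟨⟨2 * M / n, by positivity⟩, rfl⟩
  have hGupd (z : Fin n → Z) (i : Fin n) (x : Z) :
      |G (update z i x) - G z| ≤ c := by
    have h₁ := abs_le.1 (abs_deviationSup_update_sub_le P hM.le hFne hFmeas hFbd z i x)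
    have h₂ := abs_le.1 (abs_inv_mul_sum_update_sub_le (hFbd f₀ hf₀) z i x)
    have h₃ : 2 * M / n = M / n + M / n := by ring
    rw [hc, h₃, abs_le]
    simp only [G]
    constructor <;> linarith [h₁.1, h₁.2, h₂.1, h₂.2]
  have hmean : ∫ z, G z ∂Q ≤ 2 * ∫ z, rad F z ∂Q := by
    have havgint : Integrable (fun z : Fin n → Z ↦ (n : ℝ)⁻¹ * ∑ i, f₀ (z i)) Q :=
      Integrable.of_mem_Icc 0 M havg.aemeasurable
        (.of_forall fun z ↦ average_mem_Icc hM.le (hFbd f₀ hf₀) z)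
    have hzero : ∫ z, ((n : ℝ)⁻¹ * ∑ i, f₀ (z i) - ∫ w, f₀ w ∂P) ∂Q = 0 := by
      rw [integral_sub havgint (integrable_const _), integral_inv_mul_sum_pi P hn hf₀m
        (Integrable.of_mem_Icc 0 M hf₀m.aemeasurable (.of_forall (hFbd f₀ hf₀)))]
      simp [Q]
    have hdiffint : Integrable
        (fun z : Fin n → Z ↦ (n : ℝ)⁻¹ * ∑ i, f₀ (z i) - ∫ w, f₀ w ∂P) Q :=
      havgint.sub (integrable_const _)
    rw [integral_add (integrable_of_abs_le hdev (abs_deviationSup_le P hM.le hFne hFmeas hFbd))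
      hdiffint, hzero, add_zero]
    exact integral_deviationSup_le P hM.le hFc hFne hFmeas hFbd hn
  set t := 4 * M * √(Real.log (2 / δ)) / √n with ht
  have hlog : 0 ≤ Real.log (2 / δ) := Real.log_nonneg (by rw [le_div_iff₀ hδ0]; linarith)
  have htail : Q.real {z | t ≤ G z - ∫ z, G z ∂Q} ≤ δ := by
    refine ((hasSubgaussianMGF_pi_of_abs_update_sub_le (fun _ ↦ P) hG hGbd
      (fun _ ↦ c) hGupd).measure_ge_le (ε := t) (by positivity)).trans ?_
    have hexp : -t ^ 2 / (2 * ((∑ _i : Fin n, (c / 2) ^ 2 : ℝ≥0) : ℝ)) = -(8 * Real.log (2 / δ)) := by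
      rw [ht, div_pow, mul_pow, Real.sq_sqrt hlog, Real.sq_sqrt hn'.le]
      push_cast
      simp only [Finset.sum_const, Finset.card_univ, Fintype.card_fin, nsmul_eq_mul, hc]
      field_simp
      ring
    rw [hexp]
    calc Real.exp (-(8 * Real.log (2 / δ))) ≤ Real.exp (-Real.log (2 / δ)) :=
          Real.exp_le_exp.2 (by linarith)
      _ = δ / 2 := by rw [Real.exp_neg, Real.exp_log (by positivity), inv_div]
      _ ≤ δ := by linarith
  have hmeas : MeasurableSet {z | t ≤ G z - ∫ z, G z ∂Q} :=
    measurableSet_le measurable_const (hG.sub_const _)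
  calc ENNReal.ofReal (1 - δ) ≤ ENNReal.ofReal (Q.real {z | t ≤ G z - ∫ z, G z ∂Q}ᶜ) := by
        rw [probReal_compl_eq_one_sub hmeas]
        exact ENNReal.ofReal_le_ofReal (by linarith)
    _ = Q {z | t ≤ G z - ∫ z, G z ∂Q}ᶜ := ofReal_measureReal
    _ ≤ _ := by
        refine measure_mono fun z hz ↦ ?_
        have hlt : G z - ∫ z, G z ∂Q < t := not_le.1 hz
        change G z < _
        linarith

/-- expected-loss guarantee for the empirical inverted-OCE minimizer.  With
probability at least `1 − δ` over the sample, every minimizer of the empirical inverted OCE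
over `F` satisfies `R(f̂) ≤ R(f₀) + 4·E[Rad] + 4M·√(log(2/δ))/√n + (L/2)·σ_n(f̂)`, where
`σ_n(f̂)` is the empirical standard deviation of `f̂` on the sample. -/
theorem expected_loss_guarantee_eim {Z : Type*} [MeasurableSpace Z]
    (P : Measure Z) [IsProbabilityMeasure P] (M : ℝ) (hM : 0 < M)
    (F : Set (Z → ℝ)) (hFc : F.Countable) (hFne : F.Nonempty)
    (hFmeas : ∀ f ∈ F, Measurable f) (hFbd : ∀ f ∈ F, ∀ z, f z ∈ Set.Icc 0 M)
    (φ : ℝ → ℝ) (hφ : IsDisutility φ)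
    (L : ℝ) (hL : ∀ x y : ℝ, |φ x - φ y| ≤ L * |x - y|)
    (f₀ : Z → ℝ) (hf₀ : f₀ ∈ F)
    (n : ℕ) (hn : 2 ≤ n) (δ : ℝ) (hδ : δ ∈ Set.Ioc (0 : ℝ) 1) :
    ENNReal.ofReal (1 - δ) ≤
      (Measure.pi fun _ : Fin n => P)
        {z : Fin n → Z |
          ∀ fhat ∈ F, (∀ g ∈ F, IOCE φ fhat (empMeas z) ≤ IOCE φ g (empMeas z)) →
            (∫ w, fhat w ∂P) ≤ (∫ w, f₀ w ∂P) +
              4 * (∫ w, rad F w ∂(Measure.pi fun _ : Fin n => P)) +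
              4 * M * Real.sqrt (Real.log (2 / δ)) / Real.sqrt n +
              (L / 2) * Real.sqrt ((n : ℝ)⁻¹ * ∑ i : Fin n,
                (fhat (z i) - (n : ℝ)⁻¹ * ∑ j : Fin n, fhat (z j)) ^ 2)} := by
  have hn0 : n ≠ 0 := by omega
  refine (ofReal_le_measure_deviationSup_add_lt P hM hFc hFmeas hFbd hf₀ hn0 hδ).trans
    (measure_mono fun z hz fhat hfhat hmin ↦ ?_)
  have hrad : 0 ≤ ∫ w, rad F w ∂(Measure.pi fun _ : Fin n => P) :=
    integral_nonneg fun w ↦ rad_nonneg hM.le hFne hFbd w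
  have hdev : ∫ w, fhat w ∂P - (n : ℝ)⁻¹ * ∑ i, fhat (z i) ≤ deviationSup P F z :=
    le_ciSup (bddAbove_range_of_abs_le fun f : F ↦
      abs_integral_sub_average_le P hM.le (hFmeas f f.2) (hFbd f f.2) z) ⟨fhat, hfhat⟩
  have hupper := IOCE_empMeas_le_average hn0 hφ (hFmeas f₀ hf₀) z
  have hlower := average_le_IOCE_empMeas_add hn0 hφ hL (hFmeas fhat hfhat) z
  have hz' : deviationSup P F z + ((n : ℝ)⁻¹ * ∑ i, f₀ (z i) - ∫ w, f₀ w ∂P) < _ := hz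
  linarith [hmin f₀ hf₀]
end
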